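/- arXiv:2503.04430 — 13 statements merged into one kernel-verified Lean document; each statement's English description precedes it below -/
import Mathlib

section
/- Let T be a hyperaffine algebraic theory and let f ∈ T(n). Then the coefficients of f satisfy: f[i] ∧ f[j] = 0 (i.e. f[i] ∘ (f[j], π²₂) = π²₂) for all i ≠ j, and the left-associated join f[1] ∨ (f[2] ∨ (⋯ ∨ f[n])) = 1 (i.e. equals π²₁). -/
/-!
An algebraic theory (abstract clone): a family of sets `T n`,
projections `π n i` and composition `comp`, subject to the unit
and associativity laws.
-/
universe u

structure Clone where
  T : ℕ → Type u
  π : (n : ℕ) → Fin n → T n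
  comp : {n m : ℕ} → T n → (Fin n → T m) → T m
  comp_proj : ∀ {n m : ℕ} (i : Fin n) (g : Fin n → T m), comp (π n i) g = g i
  proj_comp : ∀ {n : ℕ} (f : T n), comp f (π n) = f
  assoc : ∀ {n m k : ℕ} (f : T n) (g : Fin n → T m) (h : Fin m → T k),
      comp (comp f g) h = comp f (fun i => comp (g i) h)

namespace Clone

variable (C : Clone)

/-- `f` is idempotent: `f ∘ (g,…,g) = g`. -/
def Idem {n : ℕ} (f : C.T n) : Prop :=
  ∀ (m : ℕ) (g : C.T m), C.comp f (fun _ => g) = g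

/-- `f` splits: `f(f(x¹₁,…,x¹ₙ),…,f(xⁿ₁,…,xⁿₙ)) = f(x¹₁,x²₂,…,xⁿₙ)` as an identity. -/
def Splits {n : ℕ} (f : C.T n) : Prop :=
  ∀ (m : ℕ) (x : Fin n → Fin n → C.T m),
    C.comp f (fun i => C.comp f (x i)) = C.comp f (fun i => x i i)

/-- `f` and `g` commute. -/
def Commutes {n m : ℕ} (f : C.T n) (g : C.T m) : Prop :=
  ∀ (k : ℕ) (x : Fin n → Fin m → C.T k),
    C.comp f (fun i => C.comp g (x i)) = C.comp g (fun j => C.comp f (fun i => x i j))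

/-- A theory is hyperaffine if every operation is idempotent, every pair of
operations commutes, and every operation splits. -/
def Hyperaffine : Prop :=
  (∀ (n : ℕ) (f : C.T n), C.Idem f) ∧
  (∀ (n m : ℕ) (f : C.T n) (g : C.T m), C.Commutes f g) ∧
  (∀ (n : ℕ) (f : C.T n), C.Splits f)

/-- The `i`-th coefficient `f[i] := f ∘ (π²₂,…,π²₁,…,π²₂)` with `π²₁` in position `i`. -/
def coeff {n : ℕ} (f : C.T n) (i : Fin n) : C.T 2 :=
  C.comp f (fun j => if j = i then C.π 2 0 else C.π 2 1)

/-- `a ∧ b := a ∘ (b, π²₂)` on `T 2`. -/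
def band (a b : C.T 2) : C.T 2 := C.comp a ![b, C.π 2 1]

/-- `a ∨ b := a ∘ (π²₁, b)` on `T 2`. -/
def bor (a b : C.T 2) : C.T 2 := C.comp a ![C.π 2 0, b]

/-- `¬a := a ∘ (π²₂, π²₁)` on `T 2`. -/
def bnot (a : C.T 2) : C.T 2 := C.comp a ![C.π 2 1, C.π 2 0]

/-- `p ∈ T 3` is a Mal'cev operation: `p(x,y,y) = x` and `p(x,x,y) = y`. -/
def Malcev (p : C.T 3) : Prop :=
  ∀ (m : ℕ) (x y : C.T m), C.comp p ![x, y, y] = x ∧ C.comp p ![x, x, y] = y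

/-- `a + b := p ∘ (a, π²₂, b)` on `T 2`. -/
def padd (p : C.T 3) (a b : C.T 2) : C.T 2 := C.comp p ![a, C.π 2 1, b]

/-- `-a := p ∘ (π²₂, a, π²₂)` on `T 2`. -/
def pneg (p : C.T 3) (a : C.T 2) : C.T 2 := C.comp p ![C.π 2 1, a, C.π 2 1]

end Clone

/-- Right-nested fold: `rfold op a [b, c] = op a (op b c)`. -/
def rfold {α : Type*} (op : α → α → α) : α → List α → α
  | a, [] => a
  | a, b :: l => op a (rfold op b l)

/-- Left-nested fold: `lfold op a [b, c] = op (op a b) c`. -/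
def lfold {α : Type*} (op : α → α → α) (a : α) (l : List α) : α := l.foldl op a

namespace Clone

theorem coeff_comp (C : Clone) {n m : ℕ} (f : C.T n) (i : Fin n) (a b : C.T m) :
    C.comp (C.coeff f i) ![a, b] = C.comp f (fun j => if j = i then a else b) := by
  unfold coeff
  rw [C.assoc]
  congr 1
  funext j
  split_ifs <;> simp [C.comp_proj]

variable {C : Clone}

theorem Hyperaffine.band_coeff_of_ne (hC : C.Hyperaffine) {n : ℕ} (f : C.T n) {i j : Fin n}
    (hij : i ≠ j) : C.band (C.coeff f i) (C.coeff f j) = C.π 2 1 := by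
  obtain ⟨idem, -, splits⟩ := hC
  calc C.band (C.coeff f i) (C.coeff f j)
      = C.comp f (fun k => if k = i then C.coeff f j else C.π 2 1) := C.coeff_comp f i _ _
    _ = C.comp f (fun k => C.comp f
          (fun l => if k = i ∧ l = j then C.π 2 0 else C.π 2 1)) := by
        congr 1
        funext k
        by_cases hk : k = i <;> simp [hk, coeff, idem n f 2 (C.π 2 1)]
    _ = C.comp f (fun k => if k = i ∧ k = j then C.π 2 0 else C.π 2 1) := splits n f 2 _
    _ = C.comp f (fun _ => C.π 2 1) := by
        congr 1
        funext k
        exact if_neg fun h => hij (h.1.symm.trans h.2)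
    _ = C.π 2 1 := idem n f 2 _

theorem Hyperaffine.bor_coeff (hC : C.Hyperaffine) {n : ℕ} (f : C.T n) (i : Fin n)
    (p : Fin n → Prop) [DecidablePred p] :
    C.bor (C.coeff f i) (C.comp f (fun k => if p k then C.π 2 0 else C.π 2 1)) =
      C.comp f (fun k => if k = i ∨ p k then C.π 2 0 else C.π 2 1) := by
  obtain ⟨idem, -, splits⟩ := hC
  calc C.bor (C.coeff f i) (C.comp f (fun k => if p k then C.π 2 0 else C.π 2 1))
      = C.comp f (fun k => if k = i then C.π 2 0 else
          C.comp f (fun l => if p l then C.π 2 0 else C.π 2 1)) := C.coeff_comp f i _ _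
    _ = C.comp f (fun k => C.comp f
          (fun l => if k = i ∨ p l then C.π 2 0 else C.π 2 1)) := by
        congr 1
        funext k
        by_cases hk : k = i <;> simp [hk, idem n f 2 (C.π 2 0)]
    _ = C.comp f (fun k => if k = i ∨ p k then C.π 2 0 else C.π 2 1) := splits n f 2 _

theorem Hyperaffine.rfold_bor_coeff (hC : C.Hyperaffine) {n : ℕ} (f : C.T n) (i : Fin n)
    (l : List (Fin n)) :
    rfold C.bor (C.coeff f i) (l.map (C.coeff f)) =
      C.comp f (fun k => if k ∈ i :: l then C.π 2 0 else C.π 2 1) := by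
  induction l generalizing i with
  | nil => simp [rfold, coeff]
  | cons j l ih =>
    rw [List.map_cons, rfold, ih, hC.bor_coeff f i (· ∈ j :: l)]
    simp only [List.mem_cons]

end Clone

/-- In a hyperaffine theory, the coefficients of `f ∈ T(n)` are pairwise disjoint
(`f[i] ∧ f[j] = 0` for `i ≠ j`) and their (right-nested) join
`f[1] ∨ (f[2] ∨ (⋯ ∨ f[n]))` equals `1 = π²₁`. -/
theorem coeff_disjoint_and_join_eq_one (C : Clone) (hC : C.Hyperaffine)
    (n : ℕ) (f : C.T (n + 1)) :
    (∀ i j : Fin (n + 1), i ≠ j → C.band (C.coeff f i) (C.coeff f j) = C.π 2 1) ∧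
    rfold C.bor (C.coeff f 0) (List.ofFn fun i : Fin n => C.coeff f i.succ) = C.π 2 0 := by
  refine ⟨fun i j hij => hC.band_coeff_of_ne f hij, ?_⟩
  have hmap : (List.ofFn fun i : Fin n => C.coeff f i.succ) =
      (List.ofFn (Fin.succ (n := n))).map (C.coeff f) := by
    rw [List.map_ofFn, Function.comp_def]
  have hmem (k : Fin (n + 1)) : k ∈ 0 :: List.ofFn (Fin.succ (n := n)) := by
    cases k using Fin.cases <;> simp [List.mem_ofFn]
  rw [hmap, hC.rfold_bor_coeff]
  simp only [hmem, if_true]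
  exact hC.1 _ f 2 _
end

section
/- Let T be a hyperaffine algebraic theory and let f, g ∈ T(n). If the coefficients f[i] = g[i] for all 1 ≤ i ≤ n, then f = g. -/
/-!
An algebraic theory (abstract clone): a family of sets `T n`,
projections `π n i` and composition `comp`, subject to the unit
and associativity laws.
-/
universe u

namespace Clone

variable {C : Clone}

theorem comp_coeff {n m : ℕ} (f : C.T n) (i : Fin n) (a b : C.T m) :
    C.comp (C.coeff f i) ![a, b] = C.comp f (Function.update (fun _ => b) i a) := by
  rw [coeff, C.assoc]
  congr 1
  funext j
  by_cases hj : j = i <;> simp [hj, C.comp_proj]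

theorem comp_update (hC : C.Hyperaffine) {n m : ℕ} (f : C.T n) (i : Fin n) (a : C.T m)
    (y : Fin n → C.T m) :
    C.comp f (Function.update y i a) = C.comp (C.coeff f i) ![a, C.comp f y] := by
  obtain ⟨idem, -, splits⟩ := hC
  have key := splits n f m (Function.update (fun _ => y) i fun _ => a)
  rw [comp_coeff]
  convert key.symm using 2 <;> funext j <;> by_cases hj : j = i
  · subst hj; simp
  · simp [hj]
  · subst hj; simpa using (idem n f m a).symm
  · simp [hj]

theorem comp_piecewise_eq (hC : C.Hyperaffine) {n m : ℕ} {f g : C.T n}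
    (h : ∀ i, C.coeff f i = C.coeff g i) (x : Fin n → C.T m) (z : C.T m)
    (s : Finset (Fin n)) :
    C.comp f (s.piecewise x fun _ => z) = C.comp g (s.piecewise x fun _ => z) := by
  induction s using Finset.induction_on with
  | empty => simp only [Finset.piecewise_empty, hC.1 n f m z, hC.1 n g m z]
  | insert i s _ ih =>
    rw [Finset.piecewise_insert, comp_update hC f, comp_update hC g, ih, h]

end Clone

/-- In a hyperaffine theory, an operation is determined by its coefficients. -/
theorem coeff_injective_of_hyperaffine (C : Clone) (hC : C.Hyperaffine)
    (n : ℕ) (f g : C.T n) (h : ∀ i : Fin n, C.coeff f i = C.coeff g i) : f = g := by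
  simpa only [Finset.piecewise_univ, C.proj_comp] using
    Clone.comp_piecewise_eq hC h (C.π n) f Finset.univ
end

section
/- Let T be a hyperaffine algebraic theory and let b₁,…,bₙ ∈ T(2) satisfy bᵢ ∧ bⱼ = 0 for all i ≠ j and b₁ ∨ (b₂ ∨ (⋯ ∨ bₙ)) = 1. Then there exists f ∈ T(n) whose coefficients satisfy f[i] = bᵢ for all 1 ≤ i ≤ n. -/
/-!
An algebraic theory (abstract clone): a family of sets `T n`,
projections `π n i` and composition `comp`, subject to the unit
and associativity laws.
-/
universe u

namespace Clone

variable (C : Clone)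

/-- The nested conditional `b₀(x₀, b₁(x₁, … bₙ₋₁(xₙ₋₁, z)))`. -/
def nest {m : ℕ} : {n : ℕ} → (Fin n → C.T 2) → (Fin n → C.T m) → C.T m → C.T m
  | 0, _, _, z => z
  | _ + 1, b, x, z =>
    C.comp (b 0) ![x 0, nest (fun i => b i.succ) (fun i => x i.succ) z]

theorem comp_pair {m k : ℕ} (a : C.T 2) (x y : C.T m) (h : Fin m → C.T k) :
    C.comp (C.comp a ![x, y]) h = C.comp a ![C.comp x h, C.comp y h] := by
  rw [C.assoc]
  congr 1
  funext i
  fin_cases i <;> rfl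

theorem comp_pair_proj (a : C.T 2) : C.comp a ![C.π 2 0, C.π 2 1] = a := by
  conv_rhs => rw [← C.proj_comp a]
  congr 1
  funext i
  fin_cases i <;> rfl

theorem comp_nest {n m k : ℕ} (b : Fin n → C.T 2) (x : Fin n → C.T m) (z : C.T m)
    (h : Fin m → C.T k) :
    C.comp (C.nest b x z) h = C.nest b (fun i => C.comp (x i) h) (C.comp z h) := by
  induction n with
  | zero => rfl
  | succ n ih => simp only [nest, comp_pair, ih]

theorem rfold_bor_eq_nest {n : ℕ} (b : Fin (n + 1) → C.T 2) :
    rfold C.bor (b 0) (List.ofFn fun i : Fin n => b i.succ) =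
      C.nest b (fun _ => C.π 2 0) (C.π 2 1) := by
  induction n with
  | zero => simp [rfold, nest, comp_pair_proj]
  | succ n ih =>
    rw [List.ofFn_succ, rfold, ih fun i => b i.succ]
    rfl

variable {C}

namespace Hyperaffine

theorem comp_pair_self (hC : C.Hyperaffine) {m : ℕ} (a : C.T 2) (x : C.T m) :
    C.comp a ![x, x] = x := by
  have h := hC.1 2 a m x
  rwa [show (fun _ => x : Fin 2 → C.T m) = ![x, x] by
    funext i; fin_cases i <;> rfl] at h

theorem comp_pair_left (hC : C.Hyperaffine) {m : ℕ} (a : C.T 2) (x y z : C.T m) :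
    C.comp a ![C.comp a ![x, y], z] = C.comp a ![x, z] := by
  have h := hC.2.2 2 a m ![![x, y], ![z, z]]
  have h₁ : (fun i => C.comp a ((![![x, y], ![z, z]] : Fin 2 → Fin 2 → C.T m) i)) =
      ![C.comp a ![x, y], z] := by
    funext i
    fin_cases i
    · rfl
    · exact hC.comp_pair_self a z
  have h₂ : (fun i => (![![x, y], ![z, z]] : Fin 2 → Fin 2 → C.T m) i i) = ![x, z] := by
    funext i
    fin_cases i <;> rfl
  rwa [h₁, h₂] at h

/-- If `a ∧ c = 0` then `¬a ∧ c = c`. -/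
theorem comp_zero_of_band_eq_zero (hC : C.Hyperaffine) {a c : C.T 2} (h : C.band a c = C.π 2 1) :
    C.comp a ![C.π 2 1, c] = c := by
  rw [← h, band, hC.comp_pair_left, hC.comp_pair_self]

theorem nest_const (hC : C.Hyperaffine) {n m : ℕ} (b : Fin n → C.T 2) (x : C.T m) :
    C.nest b (fun _ => x) x = x := by
  induction n with
  | zero => rfl
  | succ n ih => rw [nest, ih, hC.comp_pair_self]

theorem nest_indicator (hC : C.Hyperaffine) {n : ℕ} (b : Fin n → C.T 2)
    (hb : ∀ i j, i ≠ j → C.band (b i) (b j) = C.π 2 1) (i : Fin n) :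
    C.nest b (fun j => if j = i then C.π 2 0 else C.π 2 1) (C.π 2 1) = b i := by
  induction n with
  | zero => exact i.elim0
  | succ n ih =>
    cases i using Fin.cases with
    | zero => simp [nest, hC.nest_const, comp_pair_proj]
    | succ i =>
      have hi := ih (fun j => b j.succ)
        (fun j k hjk => hb _ _ (fun h => hjk (Fin.succ_injective _ h))) i
      simp only [nest, Fin.succ_inj, hi, (Fin.succ_ne_zero i).symm, if_false]
      exact hC.comp_zero_of_band_eq_zero (hb _ _ (Fin.succ_ne_zero i).symm)

/-- If the join of the `bᵢ` is `1`, the default value of the nested conditional is irrelevant. -/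
theorem nest_default_irrel (hC : C.Hyperaffine) {n m : ℕ} (b : Fin n → C.T 2)
    (hb : C.nest b (fun _ => C.π 2 0) (C.π 2 1) = C.π 2 0)
    (x : Fin n → C.T m) (z w : C.T m) : C.nest b x z = C.nest b x w := by
  have key (u v : C.T m) : C.nest b (fun _ => u) v = u := by
    have h := congrArg (fun g => C.comp g ![u, v]) hb
    simpa [comp_nest, C.comp_proj] using h
  have hG (h : Fin (n + 1) → C.T m) :
      C.comp (C.nest b (fun i => C.π (n + 1) i.castSucc) (C.π (n + 1) (Fin.last n))) h =
        C.nest b (fun i => h i.castSucc) (h (Fin.last n)) := by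
    simp only [comp_nest, C.comp_proj]
  let X : Fin (n + 1) → Fin (n + 1) → C.T m :=
    Fin.snoc (α := fun _ => Fin (n + 1) → C.T m) (fun i _ => x i)
      (Fin.snoc (α := fun _ => C.T m) (fun _ => w) z)
  have h := hC.2.2 _ (C.nest b (fun i => C.π (n + 1) i.castSucc) (C.π (n + 1) (Fin.last n))) m X
  simp only [hG, X, Fin.snoc_castSucc, Fin.snoc_last, key] at h
  exact h.symm

end Hyperaffine

end Clone

/-- In a hyperaffine theory, any tuple `b₁,…,bₙ ∈ T(2)` with `bᵢ ∧ bⱼ = 0` for `i ≠ j`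
and `b₁ ∨ (b₂ ∨ (⋯ ∨ bₙ)) = 1` arises as the coefficients of some `f ∈ T(n)`. -/
theorem exists_op_with_coeffs_of_hyperaffine (C : Clone) (hC : C.Hyperaffine)
    (n : ℕ) (b : Fin (n + 1) → C.T 2)
    (hmeet : ∀ i j : Fin (n + 1), i ≠ j → C.band (b i) (b j) = C.π 2 1)
    (hjoin : rfold C.bor (b 0) (List.ofFn fun i : Fin n => b i.succ) = C.π 2 0) :
    ∃ f : C.T (n + 1), ∀ i : Fin (n + 1), C.coeff f i = b i := by
  rw [C.rfold_bor_eq_nest] at hjoin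
  refine ⟨C.nest b (C.π (n + 1)) (C.π (n + 1) 0), fun i => ?_⟩
  simp only [Clone.coeff, Clone.comp_nest, C.comp_proj]
  rw [hC.nest_default_irrel b hjoin _ _ (C.π 2 1), hC.nest_indicator b hmeet]
end

section
/- Let T be a hyperaffine algebraic theory. Then the set T(2) carries a Boolean algebra structure whose operations are: meet a ∧ b := a ∘ (b, π²₂), join a ∨ b := a ∘ (π²₁, b), complement ¬a := a ∘ (π²₂, π²₁), bottom 0 := π²₂, and top 1 := π²₁ (i.e. there exists a BooleanAlgebra structure on T(2) whose inf, sup, compl, bot and top are exactly these operations). -/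
/-!
An algebraic theory (abstract clone): a family of sets `T n`,
projections `π n i` and composition `comp`, subject to the unit
and associativity laws.
-/
universe u

namespace Clone

/-- The operation `a` used as a conditional: `a ∘ (x, y)`. -/
def cond (C : Clone) {m : ℕ} (a : C.T 2) (x y : C.T m) : C.T m := C.comp a ![x, y]

section cond

variable {C : Clone} {m : ℕ}

lemma cond_top (x y : C.T m) : C.cond (C.π 2 0) x y = x := C.comp_proj 0 ![x, y]

lemma cond_bot (x y : C.T m) : C.cond (C.π 2 1) x y = y := C.comp_proj 1 ![x, y]

lemma cond_top_bot (a : C.T 2) : C.cond a (C.π 2 0) (C.π 2 1) = a := by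
  have h : ![C.π 2 0, C.π 2 1] = C.π 2 := by
    funext i; fin_cases i <;> rfl
  rw [cond, h, C.proj_comp]

lemma cond_cond (a b c : C.T 2) (x y : C.T m) :
    C.cond (C.cond a b c) x y = C.cond a (C.cond b x y) (C.cond c x y) := by
  simp only [cond, C.assoc]
  congr 1
  funext i; fin_cases i <;> rfl

lemma Hyperaffine.cond_self (hC : C.Hyperaffine) (a : C.T 2) (x : C.T m) :
    C.cond a x x = x := by
  have h : ![x, x] = fun _ => x := by
    funext i; fin_cases i <;> rfl
  rw [cond, h]
  exact hC.1 2 a m x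

lemma Hyperaffine.cond_comm (hC : C.Hyperaffine) (a b : C.T 2) (x y z w : C.T m) :
    C.cond a (C.cond b x y) (C.cond b z w) = C.cond b (C.cond a x z) (C.cond a y w) := by
  convert hC.2.1 2 2 a b m ![![x, y], ![z, w]] using 1 <;> unfold cond <;> congr 1 <;>
    funext i <;> fin_cases i <;> dsimp <;> congr 1 <;> funext j <;> fin_cases j <;> rfl

lemma Hyperaffine.cond_split (hC : C.Hyperaffine) (a : C.T 2) (x y z w : C.T m) :
    C.cond a (C.cond a x y) (C.cond a z w) = C.cond a x w := by
  convert hC.2.2 2 a m ![![x, y], ![z, w]] using 1 <;> unfold cond <;> congr 1 <;>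
    funext i <;> fin_cases i <;> rfl

lemma Hyperaffine.cond_cond_left (hC : C.Hyperaffine) (a : C.T 2) (x y z : C.T m) :
    C.cond a (C.cond a x y) z = C.cond a x z := by
  simpa only [hC.cond_self] using hC.cond_split a x y z z

lemma Hyperaffine.cond_cond_right (hC : C.Hyperaffine) (a : C.T 2) (x y z : C.T m) :
    C.cond a x (C.cond a y z) = C.cond a x z := by
  simpa only [hC.cond_self] using hC.cond_split a x x y z

lemma band_eq_cond (a b : C.T 2) : C.band a b = C.cond a b (C.π 2 1) := rfl

lemma bor_eq_cond (a b : C.T 2) : C.bor a b = C.cond a (C.π 2 0) b := rfl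

lemma Hyperaffine.band_comm (hC : C.Hyperaffine) (a b : C.T 2) : C.band a b = C.band b a := by
  simpa only [band_eq_cond, hC.cond_self, cond_top_bot] using
    hC.cond_comm a b (C.π 2 0) (C.π 2 1) (C.π 2 1) (C.π 2 1)

lemma Hyperaffine.bor_comm (hC : C.Hyperaffine) (a b : C.T 2) : C.bor a b = C.bor b a := by
  simpa only [bor_eq_cond, hC.cond_self, cond_top_bot] using
    hC.cond_comm a b (C.π 2 0) (C.π 2 0) (C.π 2 0) (C.π 2 1)

lemma band_assoc (a b c : C.T 2) : C.band (C.band a b) c = C.band a (C.band b c) := by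
  simpa only [band_eq_cond, cond_bot] using cond_cond a b (C.π 2 1) c (C.π 2 1)

lemma bor_assoc (a b c : C.T 2) : C.bor (C.bor a b) c = C.bor a (C.bor b c) := by
  simpa only [bor_eq_cond, cond_top] using cond_cond a (C.π 2 0) b (C.π 2 0) c

lemma Hyperaffine.bor_band_self (hC : C.Hyperaffine) (a b : C.T 2) :
    C.bor a (C.band a b) = a :=
  (hC.cond_cond_right a _ _ _).trans (cond_top_bot a)

lemma Hyperaffine.band_bor_self (hC : C.Hyperaffine) (a b : C.T 2) :
    C.band a (C.bor a b) = a :=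
  (hC.cond_cond_left a _ _ _).trans (cond_top_bot a)

lemma Hyperaffine.bor_band_distrib (hC : C.Hyperaffine) (a b c : C.T 2) :
    C.band (C.bor a b) (C.bor a c) = C.bor a (C.band b c) := by
  simp only [band_eq_cond, bor_eq_cond]
  have h := hC.cond_comm b a (C.π 2 0) c (C.π 2 1) (C.π 2 1)
  rw [hC.cond_self, cond_top_bot] at h
  rw [cond_cond, cond_top, h, hC.cond_split]

lemma Hyperaffine.band_bnot_self (hC : C.Hyperaffine) (a : C.T 2) :
    C.band a (C.bnot a) = C.π 2 1 :=
  (hC.cond_cond_left a _ _ _).trans (hC.cond_self a _)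

lemma Hyperaffine.bor_bnot_self (hC : C.Hyperaffine) (a : C.T 2) :
    C.bor a (C.bnot a) = C.π 2 0 :=
  (hC.cond_cond_right a _ _ _).trans (hC.cond_self a _)

/-- The lattice structure on the binary operations of a hyperaffine theory. -/
@[reducible] def Hyperaffine.lattice (hC : C.Hyperaffine) : Lattice (C.T 2) :=
  letI : Max (C.T 2) := ⟨C.bor⟩
  letI : Min (C.T 2) := ⟨C.band⟩
  Lattice.mk' hC.bor_comm bor_assoc hC.band_comm band_assoc hC.bor_band_self hC.band_bor_self

/-- The Boolean algebra structure on the binary operations of a hyperaffine theory. -/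
@[reducible] def Hyperaffine.booleanAlgebra (hC : C.Hyperaffine) : BooleanAlgebra (C.T 2) :=
  letI := hC.lattice
  { hC.lattice with
    le_sup_inf := fun a b c => (hC.bor_band_distrib a b c).le
    compl := C.bnot
    top := C.π 2 0
    bot := C.π 2 1
    inf_compl_le_bot := fun a => (hC.band_bnot_self a).le
    top_le_sup_compl := fun a => (hC.bor_bnot_self a).ge
    le_top := fun a => sup_eq_right.mp (hC.cond_self a (C.π 2 0))
    bot_le := fun a => sup_eq_right.mp (cond_bot (C.π 2 0) a)
    sdiff_eq := fun _ _ => rfl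
    himp_eq := fun _ _ => rfl }

end cond

end Clone

/-- If `T` is hyperaffine, then `T(2)` carries a Boolean algebra structure with
meet `a ∘ (b, π²₂)`, join `a ∘ (π²₁, b)`, complement `a ∘ (π²₂, π²₁)`,
bottom `π²₂` and top `π²₁`. -/
theorem booleanAlgebra_of_hyperaffine (C : Clone) (hC : C.Hyperaffine) :
    ∃ B : BooleanAlgebra (C.T 2),
      (∀ a b : C.T 2, B.inf a b = C.band a b) ∧
      (∀ a b : C.T 2, B.sup a b = C.bor a b) ∧
      (∀ a : C.T 2, B.compl a = C.bnot a) ∧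
      B.bot = C.π 2 1 ∧ B.top = C.π 2 0 :=
  ⟨hC.booleanAlgebra, fun _ _ => rfl, fun _ _ => rfl, fun _ => rfl, rfl, rfl⟩
end

section
/- Let T be a hyperaffine algebraic theory. Then for every f ∈ T(k) and g₁,…,g_k ∈ T(n) the distributive law (C5) holds: f(g₁,…,g_k) ∘ (f(x¹₁,…,x^k₁),…,f(x¹ₙ,…,x^kₙ)) = f(g₁(x¹₁,…,x¹ₙ),…,g_k(x^k₁,…,x^kₙ)), as an identity of the theory (an equation between elements of T(k·n) built from ∘ and projections, where x^i_j denotes the (i,j)-th projection in T(k·n)). -/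
/-!
An algebraic theory (abstract clone): a family of sets `T n`,
projections `π n i` and composition `comp`, subject to the unit
and associativity laws.
-/
universe u

/-- In a hyperaffine theory the distributive law (C5) holds:
`f(g₁,…,g_k) ∘ (f(x¹₁,…,x^k₁),…,f(x¹ₙ,…,x^kₙ)) = f(g₁(x¹₁,…,x¹ₙ),…,g_k(x^k₁,…,x^kₙ))`. -/
theorem c5_of_hyperaffine (C : Clone) (hC : C.Hyperaffine)
    (k n m : ℕ) (f : C.T k) (g : Fin k → C.T n) (x : Fin k → Fin n → C.T m) :
    C.comp (C.comp f g) (fun j => C.comp f (fun i => x i j)) =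
      C.comp f (fun i => C.comp (g i) (x i)) := by
  rw [C.assoc]
  calc C.comp f (fun i => C.comp (g i) (fun j => C.comp f (fun i' => x i' j)))
      = C.comp f (fun i => C.comp f (fun i' => C.comp (g i) (x i'))) := by
        congr 1
        funext i
        exact (hC.2.1 k n f (g i) m x).symm
    _ = C.comp f (fun i => C.comp (g i) (x i)) :=
        hC.2.2 k f m (fun i i' => C.comp (g i) (x i'))
end

section
/- Let T be an idempotent algebraic theory satisfying the distributive law (C5): f(g₁,…,g_k) ∘ (f(x¹₁,…,x^k₁),…,f(x¹ₙ,…,x^kₙ)) = f(g₁(x¹₁,…,x¹ₙ),…,g_k(x^k₁,…,x^kₙ)) for all f ∈ T(k) and g₁,…,g_k ∈ T(n). Then T is hyperaffine: every operation of T splits and every pair of operations of T commutes. -/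
/-!
An algebraic theory (abstract clone): a family of sets `T n`,
projections `π n i` and composition `comp`, subject to the unit
and associativity laws.
-/
universe u

/-- An idempotent theory satisfying the distributive law (C5) is hyperaffine:
every operation splits and every pair of operations commutes. -/
theorem hyperaffine_of_idem_c5 (C : Clone)
    (hidem : ∀ (n : ℕ) (f : C.T n), C.Idem f)
    (hC5 : ∀ (k n m : ℕ) (f : C.T k) (g : Fin k → C.T n) (x : Fin k → Fin n → C.T m),
      C.comp (C.comp f g) (fun j => C.comp f (fun i => x i j)) =
        C.comp f (fun i => C.comp (g i) (x i))) :
    (∀ (n : ℕ) (f : C.T n), C.Splits f) ∧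
    (∀ (n m : ℕ) (f : C.T n) (g : C.T m), C.Commutes f g) := by
  refine ⟨fun n f m x => ?_, fun n m f g k x => ?_⟩
  · simpa only [C.proj_comp, C.comp_proj] using hC5 n n m f (C.π n) (fun i j => x j i)
  · have h := hC5 n m k f (fun _ => g) x
    rw [hidem n f m g] at h
    exact h.symm
end

section
/- Let T be a hyperaffine algebraic theory and n ≥ 1. Then the set A := T(n), with constants e_i := π^n_i (1 ≤ i ≤ n) and (n+1)-ary operation q(a, b₁,…,bₙ) := a ∘ (b₁,…,bₙ), satisfies the axioms of an n-dimensional Boolean algebra: (H1) q(e_i, x₁,…,xₙ) = x_i; (H2) q(y, x,…,x) = x; (H3) q(y, q(y,x¹₁,…,x¹ₙ),…,q(y,xⁿ₁,…,xⁿₙ)) = q(y, x¹₁, x²₂,…,xⁿₙ); (H4) q(y, q(z₁,x¹₁,…,x¹ₙ),…,q(zₙ,xⁿ₁,…,xⁿₙ)) = q(q(y,z₁,…,zₙ), q(y,x¹₁,…,xⁿ₁),…,q(y,x¹ₙ,…,xⁿₙ)); (H5) q(y, e₁,…,eₙ) = y, for all elements of A. -/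
/-!
An algebraic theory (abstract clone): a family of sets `T n`,
projections `π n i` and composition `comp`, subject to the unit
and associativity laws.
-/
universe u

/-- If `T` is hyperaffine and `n ≥ 1`, then `A := T(n)` with `e_i := πⁿᵢ` and
`q(a,b₁,…,bₙ) := a ∘ (b₁,…,bₙ)` satisfies the axioms (H1)–(H5) of an
`n`-dimensional Boolean algebra. -/
theorem nBA_of_hyperaffine (C : Clone) (hC : C.Hyperaffine) (n : ℕ) (hn : 1 ≤ n) :
    -- (H1)
    (∀ (i : Fin n) (x : Fin n → C.T n), C.comp (C.π n i) x = x i) ∧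
    -- (H2)
    (∀ (y x : C.T n), C.comp y (fun _ => x) = x) ∧
    -- (H3)
    (∀ (y : C.T n) (x : Fin n → Fin n → C.T n),
      C.comp y (fun i => C.comp y (x i)) = C.comp y (fun i => x i i)) ∧
    -- (H4)
    (∀ (y : C.T n) (z : Fin n → C.T n) (x : Fin n → Fin n → C.T n),
      C.comp y (fun i => C.comp (z i) (x i)) =
        C.comp (C.comp y z) (fun j => C.comp y (fun i => x i j))) ∧
    -- (H5)
    (∀ y : C.T n, C.comp y (C.π n) = y) := by
  obtain ⟨hidem, hcomm, hsplit⟩ := hC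
  refine ⟨C.comp_proj, fun y x => hidem n y n x, fun y x => hsplit n y n x,
    fun y z x => ?_, C.proj_comp⟩
  calc C.comp y (fun i => C.comp (z i) (x i))
      = C.comp y (fun i => C.comp y (fun k => C.comp (z i) (x k))) :=
        (hsplit n y n fun i k => C.comp (z i) (x k)).symm
    _ = C.comp y (fun i => C.comp (z i) (fun j => C.comp y (fun k => x k j))) :=
        congrArg (C.comp y) (funext fun i => hcomm n n y (z i) n x)
    _ = C.comp (C.comp y z) (fun j => C.comp y (fun i => x i j)) :=
        (C.assoc y z _).symm
end

section
/- Let X be a set and p : X³ → X a Mal'cev operation (p(x,y,y) = x and p(x,x,y) = y for all x,y) that commutes with itself (p(p(x₁,y₁,z₁),p(x₂,y₂,z₂),p(x₃,y₃,z₃)) = p(p(x₁,x₂,x₃),p(y₁,y₂,y₃),p(z₁,z₂,z₃)) for all arguments). Then for all u,v,w,y ∈ X: p(u,v,w) = p(p(u, y, p(y,v,y)), y, w). (In the ring T(2) of an affine theory this reads p(a(x,y), b(x,y), c(x,y)) = (a − b + c)(x,y), with a − b + c = (a + (−b)) + c, a + b := p(a(x,y), y, b(x,y)) and −b := p(y,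 b(x,y), y).) -/
/-- Let `p` be a Mal'cev operation on a set `X` that commutes with itself.
Then `p(u,v,w) = p(p(u, y, p(y,v,y)), y, w)` for all `u,v,w,y`; in the ring
`T(2)` of an affine theory, this reads `p(a(x,y), b(x,y), c(x,y)) = (a−b+c)(x,y)`. -/
theorem malcev_eq_sub_add {X : Type*} (p : X → X → X → X)
    (hM1 : ∀ x y : X, p x y y = x) (hM2 : ∀ x y : X, p x x y = y)
    (hcomm : ∀ x₁ y₁ z₁ x₂ y₂ z₂ x₃ y₃ z₃ : X,
      p (p x₁ y₁ z₁) (p x₂ y₂ z₂) (p x₃ y₃ z₃) =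
        p (p x₁ x₂ x₃) (p y₁ y₂ y₃) (p z₁ z₂ z₃))
    (u v w y : X) :
    p u v w = p (p u y (p y v y)) y w := by
  have h₁ : p u y (p y v y) = p u v y := by
    simpa only [hM1, hM2] using hcomm u y y y y y y v y
  have h₂ : p (p u v y) y w = p u v w := by
    simpa only [hM1, hM2] using hcomm u v y v v y v v w
  rw [h₁, h₂]
end

section
/- Let T be an affine algebraic theory with Mal'cev operation p, and let f ∈ T(n). Then the left-associated sum of the coefficients of f equals 1: f[1] + f[2] + ⋯ + f[n] = 1 in T(2), where a + b := p ∘ (a, π²₂, b) and 1 := π²₁. -/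
/-!
An algebraic theory (abstract clone): a family of sets `T n`,
projections `π n i` and composition `comp`, subject to the unit
and associativity laws.
-/
universe u

theorem lfold_ofFn_eq_of_succ {α : Type*} (op : α → α → α) {n : ℕ} (g : Fin n → α) (s : ℕ → α)
    (hs : ∀ i : Fin n, s (i + 1) = op (s i) (g i)) :
    lfold op (s 0) (List.ofFn g) = s n := by
  induction n generalizing s with
  | zero => simp [lfold]
  | succ n ih =>
    have h := ih (fun i => g i.succ) (fun k => s (k + 1)) fun i => by simpa using hs i.succ
    have h0 : s 1 = op (s 0) (g 0) := by simpa using hs 0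
    simpa [lfold, List.ofFn_succ, h0] using h

/-- The value of `f` at `π²₁` in the positions up to `k` and `π²₂` elsewhere. -/
def Clone.initialSum (C : Clone) {n : ℕ} (f : C.T n) (k : ℕ) : C.T 2 :=
  C.comp f fun j => if (j : ℕ) ≤ k then C.π 2 0 else C.π 2 1

theorem Clone.comp_padd (C : Clone) {p : C.T 3} {n : ℕ} {f : C.T n}
    (hf : C.Idem f) (hpf : C.Commutes p f) (x y : Fin n → C.T 2) :
    C.padd p (C.comp f x) (C.comp f y) = C.comp f fun j => C.padd p (x j) (y j) := by
  have h := hpf 2 ![x, fun _ => C.π 2 1, y]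
  have hl : (fun i => C.comp f (![x, fun _ => C.π 2 1, y] i)) =
      ![C.comp f x, C.π 2 1, C.comp f y] := by
    funext i
    fin_cases i <;> simp [hf 2 (C.π 2 1)]
  have hr : ∀ j, (fun i => ![x, fun _ => C.π 2 1, y] i j) = ![x j, C.π 2 1, y j] := by
    intro j
    funext i
    fin_cases i <;> rfl
  simpa only [hl, hr, padd] using h

theorem Clone.initialSum_succ (C : Clone) {p : C.T 3} (hp : C.Malcev p) {n : ℕ}
    {f : C.T (n + 1)} (hf : C.Idem f) (hpf : C.Commutes p f) (i : Fin n) :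
    C.initialSum f (i + 1) = C.padd p (C.initialSum f i) (C.coeff f i.succ) := by
  rw [initialSum, initialSum, coeff, C.comp_padd hf hpf]
  congr 1
  funext j
  rcases lt_trichotomy (j : ℕ) (i + 1) with h | h | h
  · have hj : j ≠ i.succ := fun e => by simp [e] at h
    simp [hj, h.le, Nat.le_of_lt_succ h, padd, (hp 2 _ _).1]
  · have hj : j = i.succ := Fin.ext h
    simp [hj, padd, (hp 2 _ _).2]
  · have hj : j ≠ i.succ := fun e => by simp [e] at h
    have h' : ¬ (j : ℕ) ≤ i := by lia
    simp [hj, h.not_ge, h', padd, (hp 2 _ _).1]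

/-- In an affine theory with Mal'cev operation `p`, the left-associated sum of
the coefficients of `f ∈ T(n)` equals `1 = π²₁`. -/
theorem coeff_sum_eq_one_of_affine (C : Clone)
    (hidem : ∀ (n : ℕ) (f : C.T n), C.Idem f)
    (hcomm : ∀ (n m : ℕ) (f : C.T n) (g : C.T m), C.Commutes f g)
    (p : C.T 3) (hp : C.Malcev p)
    (n : ℕ) (f : C.T (n + 1)) :
    lfold (C.padd p) (C.coeff f 0) (List.ofFn fun i : Fin n => C.coeff f i.succ) =
      C.π 2 0 := by
  have h0 : C.initialSum f 0 = C.coeff f 0 := by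
    simp [Clone.initialSum, Clone.coeff]
  rw [← h0, lfold_ofFn_eq_of_succ _ _ (C.initialSum f) fun i =>
    C.initialSum_succ hp (hidem _ f) (hcomm _ _ p f) i]
  simp [Clone.initialSum, Fin.is_le, hidem _ f 2 (C.π 2 0)]
end

section
/- Let B be a Boolean ring and X a set with a binary B-action (a map assigning to each b ∈ B a function b(−,−) : X² → X). Then the action satisfies Bergman's axioms (B1)–(B5) if and only if it satisfies axioms (R1)–(R5). -/
/-- Bergman's axioms (B1)–(B5) for a binary action of a Boolean ring. -/
structure IsBergmanAction {B X : Type*} [BooleanRing B] (act : B → X → X → X) : Prop where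
  self : ∀ (b : B) (x : X), act b x x = x
  left : ∀ (b : B) (x y z : X), act b (act b x y) z = act b x z
  right : ∀ (b : B) (x y z : X), act b x (act b y z) = act b x z
  compl : ∀ (b : B) (x y : X), act (1 - b) x y = act b y x
  zero : ∀ x y : X, act 0 x y = y
  mul : ∀ (b c : B) (x y : X), act b (act c x y) y = act (b * c) x y

/-- Two points agree on `b` when `b` cannot distinguish them in its first argument. -/
def AgreeOn {B X : Type*} (act : B → X → X → X) (b : B) (x y : X) : Prop :=
  ∀ z, act b x z = act b y z

namespace AgreeOn

variable {B X : Type*} {act : B → X → X → X} {b : B} {x y z : X}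

theorem symm (h : AgreeOn act b x y) : AgreeOn act b y x := fun z => (h z).symm

theorem trans (h : AgreeOn act b x y) (h' : AgreeOn act b y z) : AgreeOn act b x z :=
  fun w => (h w).trans (h' w)

end AgreeOn

namespace IsBergmanAction

variable {B X : Type*} [BooleanRing B] {act : B → X → X → X}

theorem one (h : IsBergmanAction act) (x y : X) : act 1 x y = x := by
  have := h.compl 0 x y
  rwa [sub_zero, h.zero] at this

theorem agreeOn_iff (h : IsBergmanAction act) {b : B} {x y : X} :
    AgreeOn act b x y ↔ act b x y = y := by
  refine ⟨fun e => (e y).trans (h.self b y), fun e z => ?_⟩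
  rw [← h.left b x y z, e]

theorem agreeOn_mul_left (h : IsBergmanAction act) {b : B} {x y : X}
    (e : AgreeOn act b x y) (c : B) : AgreeOn act (c * b) x y := by
  rw [h.agreeOn_iff] at e ⊢
  rw [← h.mul, e, h.self]

theorem agreeOn_mul_right (h : IsBergmanAction act) {b : B} {x y : X}
    (e : AgreeOn act b x y) (c : B) : AgreeOn act (b * c) x y :=
  mul_comm c b ▸ h.agreeOn_mul_left e c

theorem agreeOn_sup (h : IsBergmanAction act) {b c : B} {x y : X}
    (hb : AgreeOn act b x y) (hc : AgreeOn act c x y) :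
    AgreeOn act (1 - (1 - b) * (1 - c)) x y := by
  rw [h.agreeOn_iff] at hb hc ⊢
  rw [h.compl, ← h.mul, h.compl, h.compl, hc, hb]

theorem agreeOn_of_split (h : IsBergmanAction act) {b : B} (c : B) {x y : X}
    (hc : AgreeOn act (b * c) x y) (hc' : AgreeOn act (b * (1 - c)) x y) :
    AgreeOn act b x y := by
  have key : 1 - (1 - b * c) * (1 - b * (1 - c)) = b := by
    linear_combination b * b * BooleanRing.mul_self c
  exact key ▸ h.agreeOn_sup hc hc'

theorem eq_of_agreeOn (h : IsBergmanAction act) (b : B) {x y : X}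
    (hb : AgreeOn act b x y) (hb' : AgreeOn act (1 - b) x y) : x = y := by
  have e : AgreeOn act 1 x y :=
    h.agreeOn_of_split b ((one_mul b).symm ▸ hb) ((one_mul (1 - b)).symm ▸ hb')
  simpa only [h.one] using e x

theorem agreeOn_left (h : IsBergmanAction act) (b : B) (x y : X) :
    AgreeOn act b (act b x y) x := fun z => h.left b x y z

theorem agreeOn_right (h : IsBergmanAction act) (b : B) (x y : X) :
    AgreeOn act (1 - b) (act b x y) y := fun z => by
  rw [h.compl, h.compl, h.right]

/-- Operations of the action commute with one another. -/
theorem comm (h : IsBergmanAction act) (b c : B) (x y z w : X) :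
    act b (act c x y) (act c z w) = act c (act b x z) (act b y w) := by
  apply h.eq_of_agreeOn b <;> apply h.agreeOn_of_split c
  · exact (h.agreeOn_mul_right (h.agreeOn_left b _ _) _).trans
      ((h.agreeOn_mul_left (h.agreeOn_left c _ _) _).trans
        ((h.agreeOn_mul_left (h.agreeOn_left c _ _) _).trans
          (h.agreeOn_mul_right (h.agreeOn_left b _ _) _)).symm)
  · exact (h.agreeOn_mul_right (h.agreeOn_left b _ _) _).trans
      ((h.agreeOn_mul_left (h.agreeOn_right c _ _) _).trans
        ((h.agreeOn_mul_left (h.agreeOn_right c _ _) _).trans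
          (h.agreeOn_mul_right (h.agreeOn_left b _ _) _)).symm)
  · exact (h.agreeOn_mul_right (h.agreeOn_right b _ _) _).trans
      ((h.agreeOn_mul_left (h.agreeOn_left c _ _) _).trans
        ((h.agreeOn_mul_left (h.agreeOn_left c _ _) _).trans
          (h.agreeOn_mul_right (h.agreeOn_right b _ _) _)).symm)
  · exact (h.agreeOn_mul_right (h.agreeOn_right b _ _) _).trans
      ((h.agreeOn_mul_left (h.agreeOn_right c _ _) _).trans
        ((h.agreeOn_mul_left (h.agreeOn_right c _ _) _).trans
          (h.agreeOn_mul_right (h.agreeOn_right b _ _) _)).symm)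

theorem act_act_act (h : IsBergmanAction act) (a b c : B) (x y : X) :
    act a (act b x y) (act c x y) = act (a * b + (1 - a) * c) x y := by
  have ha := BooleanRing.mul_self a
  have hb := BooleanRing.mul_self b
  have hc := BooleanRing.mul_self c
  set d := a * b + (1 - a) * c with hd
  have hx : ∀ e, e * d = e → AgreeOn act e x (act d x y) := fun e he =>
    he ▸ h.agreeOn_mul_left (h.agreeOn_left d x y).symm e
  have hy : ∀ e, e * (1 - d) = e → AgreeOn act e y (act d x y) := fun e he =>
    he ▸ h.agreeOn_mul_left (h.agreeOn_right d x y).symm e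
  apply h.eq_of_agreeOn a
  · apply h.agreeOn_of_split b <;> refine (h.agreeOn_mul_right (h.agreeOn_left a _ _) _).trans ?_
    · exact (h.agreeOn_mul_left (h.agreeOn_left b _ _) _).trans (hx _ (by grind))
    · exact (h.agreeOn_mul_left (h.agreeOn_right b _ _) _).trans (hy _ (by grind))
  · apply h.agreeOn_of_split c <;> refine (h.agreeOn_mul_right (h.agreeOn_right a _ _) _).trans ?_
    · exact (h.agreeOn_mul_left (h.agreeOn_left c _ _) _).trans (hx _ (by grind))
    · exact (h.agreeOn_mul_left (h.agreeOn_right c _ _) _).trans (hy _ (by grind))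

end IsBergmanAction

/-- For a Boolean ring `B` and a binary `B`-action on a set `X`, Bergman's axioms
(B1)–(B5) hold if and only if axioms (R1)–(R5) hold. -/
theorem bergman_iff_R_axioms {B X : Type*} [BooleanRing B] (act : B → X → X → X) :
    -- (B1)-(B5)
    ((∀ (b : B) (x : X), act b x x = x) ∧
     (∀ (b : B) (x y z : X),
        act b (act b x y) z = act b x z ∧ act b x (act b y z) = act b x z) ∧
     (∀ (b : B) (x y : X), act (1 - b) x y = act b y x) ∧
     (∀ x y : X, act 0 x y = y) ∧
     (∀ (b c : B) (x y : X), act b (act c x y) y = act (b * c) x y))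
    ↔
    -- (R1)-(R5)
    ((∀ (b : B) (x : X), act b x x = x) ∧
     (∀ (b c : B) (x y z w : X),
        act b (act c x y) (act c z w) = act c (act b x z) (act b y w)) ∧
     ((∀ x y : X, act 1 x y = x) ∧ (∀ x y : X, act 0 x y = y)) ∧
     (∀ (a b c : B) (x y : X),
        act a (act b x y) (act c x y) = act (a * b + (1 - a) * c) x y) ∧
     (∀ (b : B) (x y z w : X), act b (act b x y) (act b z w) = act b x w)) := by
  constructor
  · rintro ⟨h1, h2, h3, h4, h5⟩
    have h : IsBergmanAction act :=
      ⟨h1, fun b x y z => (h2 b x y z).1, fun b x y z => (h2 b x y z).2, h3, h4, h5⟩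
    exact ⟨h1, h.comm, ⟨h.one, h4⟩, h.act_act_act,
      fun b x y z w => by rw [h.left, h.right]⟩
  · rintro ⟨r1, -, ⟨r3, r3'⟩, r4, r5⟩
    refine ⟨r1, fun b x y z => ⟨?_, ?_⟩, fun b x y => ?_, r3', fun b c x y => ?_⟩
    · simpa only [r1] using r5 b x y z z
    · simpa only [r1] using r5 b x x y z
    · simpa only [r3, r3', mul_zero, mul_one, zero_add] using (r4 b 0 1 x y).symm
    · simpa only [r3', mul_zero, add_zero] using r4 b c 0 x y
end

section
/- Let B be a Boolean ring, X a set with a binary B-action satisfying (R1)–(R4), a ternary operation p : X³ → X satisfying (A1)–(A4), and a chosen element o ∈ X. Define x + y := p(x,o,y). Then (X, +, o) is an abelian group in which every element has order dividing 2 (x + y = y + x, (x+y)+z = x+(y+z), x + o = x, x + x = o for all x,y,z ∈ X), and the action is linear, i.e. satisfies (L1): b(x,y) + b(z,w) = b(x+z, y+w) for all b ∈ B and x,y,z,w ∈ X. -/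
/-- Given a Boolean ring `B`, a set `X` with a binary `B`-action satisfying (R1)–(R4),
a ternary operation `p` satisfying (A1)–(A4), and a chosen element `o`, the operation
`x + y := p(x,o,y)` makes `X` an abelian group of exponent 2, and the action is
linear, i.e. satisfies (L1). -/
theorem vectorSpace_structure_of_affine_action {B X : Type*} [BooleanRing B]
    (act : B → X → X → X)
    (R1 : ∀ (b : B) (x : X), act b x x = x)
    (R2 : ∀ (b c : B) (x y z w : X),
      act b (act c x y) (act c z w) = act c (act b x z) (act b y w))
    (R3₁ : ∀ x y : X, act 1 x y = x) (R3₂ : ∀ x y : X, act 0 x y = y)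
    (R4 : ∀ (a b c : B) (x y : X),
      act a (act b x y) (act c x y) = act (a * b + (1 - a) * c) x y)
    (p : X → X → X → X)
    (A1₁ : ∀ x y : X, p x y y = x) (A1₂ : ∀ x y : X, p x x y = y)
    (A2₁ : ∀ x₁ y₁ z₁ x₂ y₂ z₂ x₃ y₃ z₃ : X,
      p (p x₁ y₁ z₁) (p x₂ y₂ z₂) (p x₃ y₃ z₃) =
        p (p x₁ x₂ x₃) (p y₁ y₂ y₃) (p z₁ z₂ z₃))
    (A2₂ : ∀ (b : B) (x y z u v w : X),
      act b (p x y z) (p u v w) = p (act b x u) (act b y v) (act b z w))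
    (A3 : ∀ x y : X, p y x y = act (1 + 1 : B) y x)
    (A4 : ∀ (a b c : B) (x y : X),
      p (act a x y) (act b x y) (act c x y) = act (a - b + c) x y)
    (o : X) :
    (∀ x y : X, p x o y = p y o x) ∧
    (∀ x y z : X, p (p x o y) o z = p x o (p y o z)) ∧
    (∀ x : X, p x o o = x) ∧
    (∀ x : X, p x o x = o) ∧
    (∀ (b : B) (x y z w : X),
      p (act b x y) o (act b z w) = act b (p x o z) (p y o w)) := by
  refine ⟨fun x y => ?_, fun x y z => ?_, fun x => A1₁ x o, fun x => ?_, fun b x y z w => ?_⟩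
  · simpa only [A1₁, A1₂] using A2₁ o o x o o o y o o
  · simpa only [A1₁, A1₂] using A2₁ x o y o o o o o z
  · rw [A3, BooleanRing.add_self, R3₂]
  · rw [A2₂, R1]
end

section
/- Let B be a Boolean ring and X an additive commutative group with x + x = 0 for all x ∈ X (equivalently, a vector space over 𝔽₂), equipped with a binary B-action satisfying (R1)–(R4) and the linearity axiom (L1): b(x,y) + b(z,w) = b(x+z, y+w). Then the action satisfies (B2): b(b(x,y),z) = b(x,z) and b(x,b(y,z)) = b(x,z) for all b ∈ B and x,y,z ∈ X; in particular b(x,y) = b(x,0) + (1−b)(y,0) for all b, x, y, and X is a B-set (satisfies (B1)–(B5)). -/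
/-- Given a Boolean ring `B` and an additive abelian group `X` of exponent 2
(an `𝔽₂`-vector space) with a binary `B`-action satisfying (R1)–(R4) and (L1),
the action satisfies (B2); in particular `b(x,y) = b(x,0) + (1−b)(y,0)`, and
`X` is a `B`-set, i.e. satisfies (B1)–(B5). -/
theorem bset_of_linear_action {B X : Type*} [BooleanRing B] [AddCommGroup X]
    (h2 : ∀ x : X, x + x = 0)
    (act : B → X → X → X)
    (R1 : ∀ (b : B) (x : X), act b x x = x)
    (R2 : ∀ (b c : B) (x y z w : X),
      act b (act c x y) (act c z w) = act c (act b x z) (act b y w))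
    (R3₁ : ∀ x y : X, act 1 x y = x) (R3₂ : ∀ x y : X, act 0 x y = y)
    (R4 : ∀ (a b c : B) (x y : X),
      act a (act b x y) (act c x y) = act (a * b + (1 - a) * c) x y)
    (L1 : ∀ (b : B) (x y z w : X), act b x y + act b z w = act b (x + z) (y + w)) :
    -- (B2)
    (∀ (b : B) (x y z : X),
      act b (act b x y) z = act b x z ∧ act b x (act b y z) = act b x z) ∧
    -- decomposition
    (∀ (b : B) (x y : X), act b x y = act b x 0 + act (1 - b) y 0) ∧
    -- X is a B-set: (B1)-(B5)
    ((∀ (b : B) (x : X), act b x x = x) ∧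
     (∀ (b : B) (x y z : X),
        act b (act b x y) z = act b x z ∧ act b x (act b y z) = act b x z) ∧
     (∀ (b : B) (x y : X), act (1 - b) x y = act b y x) ∧
     (∀ x y : X, act 0 x y = y) ∧
     (∀ (b c : B) (x y : X), act b (act c x y) y = act (b * c) x y)) := by
  have add_parts (b : B) (x y : X) : act b x 0 + act b 0 y = act b x y := by
    rw [L1, add_zero, zero_add]
  have B5 (b c : B) (x y : X) : act b (act c x y) y = act (b * c) x y := by
    simpa [R3₂] using R4 b c 0 x y
  have B3 (b : B) (x y : X) : act (1 - b) x y = act b y x := by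
    simpa [R3₁, R3₂] using (R4 b 0 1 x y).symm
  have left_left (b : B) (x : X) : act b (act b x 0) 0 = act b x 0 := by
    rw [B5, BooleanRing.mul_self]
  have right_left (b : B) (x : X) : act b 0 (act b x 0) = 0 := by
    have h := add_parts b (act b x 0) (act b x 0)
    rwa [R1, left_left, add_eq_left] at h
  have left_right (b : B) (y : X) : act b (act b 0 y) 0 = 0 := by
    have h := L1 b (act b y 0) 0 (act b 0 y) 0
    rwa [add_parts, R1, left_left, add_zero, add_eq_left] at h
  have right_right (b : B) (y : X) : act b 0 (act b 0 y) = act b 0 y := by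
    have h := add_parts b (act b 0 y) (act b 0 y)
    rwa [R1, left_right, zero_add] at h
  have B2 (b : B) (x y z : X) :
      act b (act b x y) z = act b x z ∧ act b x (act b y z) = act b x z := by
    constructor
    · calc
        act b (act b x y) z = act b (act b x 0 + act b 0 y) (0 + z) := by
          rw [add_parts, zero_add]
        _ = act b (act b x 0) 0 + act b (act b 0 y) z := (L1 _ _ _ _ _).symm
        _ = act b x z := by
          rw [← add_parts b (act b 0 y) z, left_left, left_right, zero_add, add_parts]
    · calc
        act b x (act b y z) = act b (0 + x) (act b y 0 + act b 0 z) := by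
          rw [add_parts, zero_add]
        _ = act b 0 (act b y 0) + act b x (act b 0 z) := (L1 _ _ _ _ _).symm
        _ = act b x z := by
          rw [← add_parts b x (act b 0 z), right_left, right_right, zero_add, add_parts]
  exact ⟨B2, fun b x y => by rw [B3, add_parts], R1, B2, B3, R3₂, B5⟩
end

section
/- Let X be a set and p : X³ → X a Mal'cev operation (p(x,y,y) = x and p(x,x,y) = y for all x,y) that commutes with itself. Then p satisfies (M1) p(x,y,p(t,u,v)) = p(p(x,y,t),u,v) and (M2) p(x,y,z) = p(z,y,x) for all x,y,z,t,u,v ∈ X. -/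
/-- A Mal'cev operation on a set which commutes with itself satisfies
(M1) `p(x,y,p(t,u,v)) = p(p(x,y,t),u,v)` and (M2) `p(x,y,z) = p(z,y,x)`. -/
theorem malcev_self_commuting_M1_M2 {X : Type*} (p : X → X → X → X)
    (hM1 : ∀ x y : X, p x y y = x) (hM2 : ∀ x y : X, p x x y = y)
    (hcomm : ∀ x₁ y₁ z₁ x₂ y₂ z₂ x₃ y₃ z₃ : X,
      p (p x₁ y₁ z₁) (p x₂ y₂ z₂) (p x₃ y₃ z₃) =
        p (p x₁ x₂ x₃) (p y₁ y₂ y₃) (p z₁ z₂ z₃)) :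
    (∀ x y t u v : X, p x y (p t u v) = p (p x y t) u v) ∧
    (∀ x y z : X, p x y z = p z y x) := by
  refine ⟨fun x y t u v => ?_, fun x y z => ?_⟩
  · simpa only [hM1, hM2] using (hcomm x y t y y u y y v).symm
  · simpa only [hM1, hM2] using hcomm y y x y y y z y y
end
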